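/- Suppose h ∈ ℝ[x₁,…,xₙ] is a homogeneous polynomial hyperbolic with respect to e ∈ ℝⁿ with h(e) > 0, and suppose e₀, e₁, …, e_m all lie in the closure of the hyperbolicity cone of h containing e. Then all Taylor coefficients of the polynomial p(x₁,…,x_m) = h(e₀ + x₁e₁ + ⋯ + x_m e_m) are nonnegative. -/

import Mathlib

/-- `h(e) ≠ 0` and for every real `x` and complex `μ`, `h(x + μe) = 0` implies `μ` is real.
(Homogeneity, which is also part of hyperbolicity, is assumed separately.) -/
def IsHyperbolicWrt {n : ℕ} (h : MvPolynomial (Fin n) ℝ) (e : Fin n → ℝ) : Prop :=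
  MvPolynomial.eval e h ≠ 0 ∧
    ∀ (x : Fin n → ℝ) (μ : ℂ),
      MvPolynomial.aeval (fun i => (x i : ℂ) + μ * (e i : ℂ)) h = 0 → μ.im = 0

/-- The hyperbolicity cone of `h` at `e`: those `x` for which the univariate polynomial
`t ↦ h(x + te)` has only negative zeros. -/
def hypCone {n : ℕ} (h : MvPolynomial (Fin n) ℝ) (e : Fin n → ℝ) : Set (Fin n → ℝ) :=
  {x | ∀ μ : ℂ, MvPolynomial.aeval (fun i => (x i : ℂ) + μ * (e i : ℂ)) h = 0 →
    ∃ r : ℝ, μ = (r : ℂ) ∧ r < 0}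

/-- A real zero polynomial: for every real `x` and complex `μ`, `p(μx) = 0` implies `μ` real. -/
def IsRealZeroPoly {n : ℕ} (p : MvPolynomial (Fin n) ℝ) : Prop :=
  ∀ (x : Fin n → ℝ) (μ : ℂ),
    MvPolynomial.aeval (fun i => μ * (x i : ℂ)) p = 0 → μ.im = 0

section PolynomialLemmas

open Polynomial in
theorem Polynomial.natDegree_prod_le_and_coeff {ι R : Type*} [CommSemiring R] (s : Finset ι)
    (f : ι → R[X]) (k : ι → ℕ) (hf : ∀ i, (f i).natDegree ≤ k i) :
    (∏ i ∈ s, f i).natDegree ≤ ∑ i ∈ s, k i ∧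
      (∏ i ∈ s, f i).coeff (∑ i ∈ s, k i) = ∏ i ∈ s, (f i).coeff (k i) := by
  classical
  induction s using Finset.induction_on with
  | empty => simp
  | insert i s hi ih =>
    rw [Finset.prod_insert hi, Finset.sum_insert hi, Finset.prod_insert hi, ← ih.2]
    exact ⟨natDegree_mul_le_of_le (hf i) ih.1, coeff_mul_add_eq_of_natDegree_le (hf i) ih.1⟩

open MvPolynomial in
theorem aeval_smul_of_isHomogeneous {σ R A : Type*} [Fintype σ] [CommSemiring R]
    [CommSemiring A] [Algebra R A] {h : MvPolynomial σ R} {d : ℕ} (hh : h.IsHomogeneous d)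
    (c : A) (x : σ → A) : aeval (c • x) h = c ^ d * aeval x h := by
  rw [aeval_def, aeval_def, eval₂_eq', eval₂_eq', Finset.mul_sum]
  refine Finset.sum_congr rfl fun m hm => ?_
  have hd : ∑ i, m i = d := by
    rw [← Finsupp.degree_eq_sum]
    exact (hh.degree_eq_sum_deg_support hm).symm
  simp only [Pi.smul_apply, smul_eq_mul, mul_pow, Finset.prod_mul_distrib,
    Finset.prod_pow_eq_pow_sum, hd]
  ring

theorem MvPolynomial.derivation_aeval {σ R A : Type*} [Fintype σ] [CommSemiring R]
    [CommSemiring A] [Algebra R A] (D : Derivation R A A) (f : σ → A) (p : MvPolynomial σ R) :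
    D (aeval f p) = ∑ j, aeval f (pderiv j p) * D (f j) := by
  classical
  induction p using MvPolynomial.induction_on with
  | C r => simp
  | add p q hp hq => simp [hp, hq, add_mul, Finset.sum_add_distrib]
  | mul_X p i hp =>
    simp only [map_mul, aeval_X, Derivation.leibniz, hp, smul_eq_mul, pderiv_X, map_add,
      add_mul, Finset.sum_add_distrib, Finset.mul_sum]
    congr 1
    · rw [Finset.sum_eq_single i]
      · simp
      · intro j _ hj
        simp [hj.symm]
      · simp
    · exact Finset.sum_congr rfl fun j _ => by ring

/-- The derivative of `h` in direction `v`. -/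
noncomputable def dirDeriv {σ R : Type*} [Fintype σ] [CommSemiring R] (v : σ → R)
    (h : MvPolynomial σ R) : MvPolynomial σ R :=
  ∑ j, MvPolynomial.C (v j) * MvPolynomial.pderiv j h

theorem MvPolynomial.IsHomogeneous.dirDeriv {σ R : Type*} [Fintype σ] [CommSemiring R]
    {h : MvPolynomial σ R} {d : ℕ} (hh : h.IsHomogeneous d) (v : σ → R) :
    (dirDeriv v h).IsHomogeneous (d - 1) :=
  IsHomogeneous.sum _ _ _ fun _ _ => hh.pderiv.C_mul _

theorem aeval_dirDeriv {σ R A : Type*} [Fintype σ] [CommSemiring R] [CommSemiring A]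
    [Algebra R A] (v : σ → R) (h : MvPolynomial σ R) (f : σ → A) :
    MvPolynomial.aeval f (dirDeriv v h) =
      ∑ j, MvPolynomial.aeval f (MvPolynomial.pderiv j h) * algebraMap R A (v j) := by
  simp [dirDeriv, mul_comm]

theorem eval_dirDeriv_self {σ R : Type*} [Fintype σ] [CommSemiring R]
    {h : MvPolynomial σ R} {d : ℕ} (hh : h.IsHomogeneous d) (v : σ → R) :
    MvPolynomial.eval v (dirDeriv v h) = d * MvPolynomial.eval v h := by
  have := congrArg (MvPolynomial.eval v) hh.sum_X_mul_pderiv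
  simpa [dirDeriv] using this

end PolynomialLemmas

section Line

open Polynomial MvPolynomial

variable {σ : Type*} [Fintype σ] {h : MvPolynomial σ ℝ} {d : ℕ}

/-- The univariate polynomial `z ↦ h(a + z b)`. -/
noncomputable def linePoly (h : MvPolynomial σ ℝ) (a b : σ → ℂ) : ℂ[X] :=
  MvPolynomial.aeval (fun i => Polynomial.C (a i) + Polynomial.C (b i) * Polynomial.X) h

omit [Fintype σ] in
theorem eval_linePoly (h : MvPolynomial σ ℝ) (a b : σ → ℂ) (z : ℂ) :
    (linePoly h a b).eval z = MvPolynomial.aeval (a + z • b) h := by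
  rw [← Polynomial.coe_aeval_eq_eval]
  refine (MvPolynomial.comp_aeval_apply
    (fun i => Polynomial.C (a i) + Polynomial.C (b i) * Polynomial.X)
    ((Polynomial.aeval z : ℂ[X] →ₐ[ℂ] ℂ).restrictScalars ℝ) h).trans ?_
  congr 2
  funext i
  change Polynomial.aeval z (Polynomial.C (a i) + Polynomial.C (b i) * Polynomial.X) = _
  rw [Polynomial.coe_aeval_eq_eval, Polynomial.eval_add, Polynomial.eval_mul, Polynomial.eval_C,
    Polynomial.eval_C, Polynomial.eval_X, mul_comm]
  rfl

theorem linePoly_natDegree_le_and_coeff (hh : h.IsHomogeneous d) (a b : σ → ℂ) :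
    (linePoly h a b).natDegree ≤ d ∧ (linePoly h a b).coeff d = MvPolynomial.aeval b h := by
  have key : ∀ m ∈ h.support,
      (∏ i, (Polynomial.C (a i) + Polynomial.C (b i) * Polynomial.X) ^ m i).natDegree ≤ d ∧
      (∏ i, (Polynomial.C (a i) + Polynomial.C (b i) * Polynomial.X) ^ m i).coeff d =
        ∏ i, b i ^ m i := by
    intro m hm
    have hd : ∑ i, m i = d := by
      rw [← Finsupp.degree_eq_sum]
      exact (hh.degree_eq_sum_deg_support hm).symm
    have h1 : ∀ i, (Polynomial.C (a i) + Polynomial.C (b i) * Polynomial.X).natDegree ≤ 1 := by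
      intro i
      rw [add_comm]
      exact Polynomial.natDegree_linear_le
    have h2 := Polynomial.natDegree_prod_le_and_coeff Finset.univ
      (fun i => (Polynomial.C (a i) + Polynomial.C (b i) * Polynomial.X) ^ m i) m
      (fun i => by simpa using Polynomial.natDegree_pow_le_of_le (m i) (h1 i))
    rw [hd] at h2
    refine ⟨h2.1, h2.2.trans (Finset.prod_congr rfl fun i _ => ?_)⟩
    have := Polynomial.coeff_pow_of_natDegree_le (m := m i) (h1 i)
    rw [mul_one] at this
    rw [this]
    simp
  rw [linePoly, MvPolynomial.aeval_def, MvPolynomial.aeval_def, MvPolynomial.eval₂_eq',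
    MvPolynomial.eval₂_eq']
  have hC : ∀ r : ℝ, algebraMap ℝ ℂ[X] r = Polynomial.C (r : ℂ) := fun r => rfl
  constructor
  · refine Polynomial.natDegree_sum_le_of_forall_le _ _ fun m hm => ?_
    rw [hC]
    exact (Polynomial.natDegree_C_mul_le _ _).trans (key m hm).1
  · rw [Polynomial.finsetSum_coeff]
    refine Finset.sum_congr rfl fun m hm => ?_
    rw [hC, Polynomial.coeff_C_mul, (key m hm).2]
    rfl

theorem linePoly_natDegree (hh : h.IsHomogeneous d) (a : σ → ℂ) {b : σ → ℂ}
    (hb : MvPolynomial.aeval b h ≠ 0) : (linePoly h a b).natDegree = d :=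
  le_antisymm (linePoly_natDegree_le_and_coeff hh a b).1
    (Polynomial.le_natDegree_of_ne_zero (by rwa [(linePoly_natDegree_le_and_coeff hh a b).2]))

theorem linePoly_ne_zero (hh : h.IsHomogeneous d) (a : σ → ℂ) {b : σ → ℂ}
    (hb : MvPolynomial.aeval b h ≠ 0) : linePoly h a b ≠ 0 := by
  intro h0
  have := (linePoly_natDegree_le_and_coeff hh a b).2
  rw [h0, Polynomial.coeff_zero] at this
  exact hb this.symm

theorem norm_mul_pow_le_of_roots_far (hh : h.IsHomogeneous d) (a : σ → ℂ) {b : σ → ℂ}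
    (hb : MvPolynomial.aeval b h ≠ 0) {z : ℂ} {ε : ℝ} (hε : 0 ≤ ε)
    (hz : ∀ w, MvPolynomial.aeval (a + w • b) h = 0 → ε ≤ ‖z - w‖) :
    ‖MvPolynomial.aeval b h‖ * ε ^ d ≤ ‖MvPolynomial.aeval (a + z • b) h‖ := by
  have hs := IsAlgClosed.splits (linePoly h a b)
  have hcard : (linePoly h a b).roots.card = d := by
    rw [← hs.natDegree_eq_card_roots, linePoly_natDegree hh a hb]
  rw [← eval_linePoly, hs.eval_eq_prod_roots, norm_mul, Polynomial.leadingCoeff,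
    linePoly_natDegree hh a hb, (linePoly_natDegree_le_and_coeff hh a b).2]
  gcongr
  rw [← hcard]
  have hroots : ∀ w ∈ (linePoly h a b).roots, ε ≤ ‖z - w‖ := by
    intro w hw
    refine hz w ?_
    rw [← eval_linePoly]
    exact (Polynomial.mem_roots'.1 hw).2
  generalize (linePoly h a b).roots = S at hroots
  induction S using Multiset.induction_on with
  | empty => simp
  | cons w S ih =>
    simp only [Multiset.card_cons, Multiset.map_cons, Multiset.prod_cons, norm_mul, pow_succ']
    exact mul_le_mul (hroots w (Multiset.mem_cons_self _ _))
      (ih fun v hv => hroots v (Multiset.mem_cons_of_mem hv)) (by positivity) (by positivity)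

omit [Fintype σ] in
theorem continuous_aeval_complex (h : MvPolynomial σ ℝ) :
    Continuous fun x : σ → ℂ => MvPolynomial.aeval x h := by
  have : (fun x : σ → ℂ => MvPolynomial.aeval x h) =
      fun x => MvPolynomial.eval x (MvPolynomial.map (algebraMap ℝ ℂ) h) := by
    funext x
    rw [MvPolynomial.eval_map, MvPolynomial.aeval_def]
  rw [this]
  exact MvPolynomial.continuous_eval _

theorem isOpen_setOf_exists_root (hh : h.IsHomogeneous d) {b : σ → ℂ}
    (hb : MvPolynomial.aeval b h ≠ 0) {a : ℝ → σ → ℂ} (ha : Continuous a) {U : Set ℂ}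
    (hU : IsOpen U) : IsOpen {s | ∃ z ∈ U, MvPolynomial.aeval (a s + z • b) h = 0} := by
  rw [isOpen_iff_mem_nhds]
  rintro s ⟨z, hzU, hz⟩
  obtain ⟨ε, hε, hball⟩ := Metric.isOpen_iff.1 hU z hzU
  have hpos : 0 < ‖MvPolynomial.aeval b h‖ * ε ^ d := by positivity
  have hcont : Continuous fun s => ‖MvPolynomial.aeval (a s + z • b) h‖ :=
    ((continuous_aeval_complex h).comp (ha.add continuous_const)).norm
  have hev : ∀ᶠ t in nhds s,
      ‖MvPolynomial.aeval (a t + z • b) h‖ < ‖MvPolynomial.aeval b h‖ * ε ^ d :=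
    hcont.continuousAt.eventually_lt continuousAt_const (by simpa [hz] using hpos)
  filter_upwards [hev] with t ht
  by_contra hcon
  replace hcon := fun z hz h0 => hcon ⟨z, hz, h0⟩
  refine absurd (norm_mul_pow_le_of_roots_far hh (a t) hb hε.le fun w hw => ?_) (not_le.2 ht)
  by_contra hlt
  exact hcon w (hball (by rw [Metric.mem_ball, dist_comm, dist_eq_norm]; exact not_le.1 hlt)) hw

theorem exists_root_bound (hh : h.IsHomogeneous d) {b : σ → ℂ}
    (hb : MvPolynomial.aeval b h ≠ 0) {K : Set (σ → ℂ)} (hK : IsCompact K) :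
    ∃ R, ∀ a ∈ K, ∀ z : ℂ, MvPolynomial.aeval (a + z • b) h = 0 → ‖z‖ ≤ R := by
  obtain ⟨δ, hδ, hball⟩ := Metric.eventually_nhds_iff.1
    ((continuous_aeval_complex h).continuousAt.eventually_ne hb)
  obtain ⟨M, hM⟩ := hK.isBounded.exists_norm_le
  refine ⟨max (M / δ) 0, fun a ha z hz => ?_⟩
  by_contra hlt
  rw [not_le, max_lt_iff, div_lt_iff₀ hδ] at hlt
  have hz0 : z ≠ 0 := norm_pos_iff.1 hlt.2
  have hsplit : a + z • b = z • (z⁻¹ • a + b) := by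
    rw [smul_add, smul_smul, mul_inv_cancel₀ hz0, one_smul]
  rw [hsplit, aeval_smul_of_isHomogeneous hh, mul_eq_zero] at hz
  refine hball ?_ (hz.resolve_left (pow_ne_zero _ hz0))
  rw [dist_eq_norm, add_sub_cancel_right, norm_smul, norm_inv, inv_mul_lt_iff₀ hlt.2]
  exact (hM a ha).trans_lt hlt.1

theorem isClosed_setOf_exists_root (hh : h.IsHomogeneous d) {b : σ → ℂ}
    (hb : MvPolynomial.aeval b h ≠ 0) {a : ℝ → σ → ℂ} (ha : Continuous a) {F : Set ℂ}
    (hF : IsClosed F) :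
    IsClosed {s | s ∈ Set.Icc (0 : ℝ) 1 ∧ ∃ z ∈ F, MvPolynomial.aeval (a s + z • b) h = 0} := by
  obtain ⟨R, hR⟩ := exists_root_bound hh hb (isCompact_Icc.image ha : IsCompact (a '' Set.Icc 0 1))
  have hcl : IsClosed {q : ℝ × ℂ | q.2 ∈ F ∧ MvPolynomial.aeval (a q.1 + q.2 • b) h = 0} := by
    refine (hF.preimage continuous_snd).inter (isClosed_eq ?_ continuous_const)
    exact (continuous_aeval_complex h).comp
      ((ha.comp continuous_fst).add (continuous_snd.smul continuous_const))
  have hcpt := ((isCompact_Icc (a := (0 : ℝ)) (b := 1)).prod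
    (isCompact_closedBall (0 : ℂ) R)).inter_right hcl
  convert (hcpt.image continuous_fst).isClosed using 1
  ext s
  constructor
  · rintro ⟨hs, z, hz, h0⟩
    exact ⟨(s, z), ⟨⟨hs, by simpa using hR _ ⟨s, hs, rfl⟩ z h0⟩, hz, h0⟩, rfl⟩
  · rintro ⟨⟨s, z⟩, ⟨⟨hs, -⟩, hz, h0⟩, rfl⟩
    exact ⟨hs, z, hz, h0⟩

/-- If along a path the roots of `z ↦ h(a s + z b)` stay in the union of two disjoint open sets
and start in the first one, they end in the first one. -/
theorem roots_mem_of_homotopy (hh : h.IsHomogeneous d) {b : σ → ℂ}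
    (hb : MvPolynomial.aeval b h ≠ 0) {a : ℝ → σ → ℂ} (ha : Continuous a) {A B : Set ℂ}
    (hA : IsOpen A) (hB : IsOpen B) (hAB : Disjoint A B)
    (hroots : ∀ s ∈ Set.Icc (0 : ℝ) 1, ∀ z, MvPolynomial.aeval (a s + z • b) h = 0 → z ∈ A ∪ B)
    (hstart : ∀ z, MvPolynomial.aeval (a 0 + z • b) h = 0 → z ∈ A)
    {z : ℂ} (hz : MvPolynomial.aeval (a 1 + z • b) h = 0) : z ∈ A := by
  by_contra hzA
  obtain ⟨s, hs, ⟨w, hwB, hw⟩, hsV⟩ := isPreconnected_Icc (a := (0 : ℝ)) (b := 1) _ _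
    (isOpen_setOf_exists_root hh hb ha hB)
    (isClosed_setOf_exists_root hh hb ha hA.isClosed_compl).isOpen_compl
    (by
      intro s hs
      by_cases hr : ∃ z ∈ Aᶜ, MvPolynomial.aeval (a s + z • b) h = 0
      · obtain ⟨w, hwA, hw⟩ := hr
        exact Or.inl ⟨w, (hroots s hs w hw).resolve_left hwA, hw⟩
      · exact Or.inr fun hc => hr hc.2)
    ⟨1, by simp, z, (hroots 1 (by simp) z hz).resolve_left hzA, hz⟩
    ⟨0, by simp, fun ⟨_, w, hwA, hw⟩ => hwA (hstart w hw)⟩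
  exact hsV ⟨hs, w, fun hwA => hAB.le_bot ⟨hwA, hwB⟩, hw⟩

theorem derivative_linePoly (h : MvPolynomial σ ℝ) (a : σ → ℂ) (v : σ → ℝ) :
    (linePoly h a (fun i => (v i : ℂ))).derivative =
      linePoly (dirDeriv v h) a (fun i => (v i : ℂ)) := by
  have := MvPolynomial.derivation_aeval
    (Derivation.restrictScalars ℝ (Polynomial.derivative' (R := ℂ)))
    (fun i => Polynomial.C (a i) + Polynomial.C (v i : ℂ) * Polynomial.X) h
  simp only [Derivation.restrictScalars_apply, Polynomial.derivative'_apply] at this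
  rw [linePoly, linePoly, this, aeval_dirDeriv]
  refine Finset.sum_congr rfl fun j _ => ?_
  simp

end Line

section Garding

open MvPolynomial

variable {n d : ℕ} {h : MvPolynomial (Fin n) ℝ} {e u v x y : Fin n → ℝ}

/-- A real vector regarded as a complex one. -/
def complexify (x : Fin n → ℝ) : Fin n → ℂ := fun i => (x i : ℂ)

theorem continuous_complexify : Continuous (complexify (n := n)) :=
  continuous_pi fun i => Complex.continuous_ofReal.comp (continuous_apply i)

theorem aeval_complexify (h : MvPolynomial (Fin n) ℝ) (x : Fin n → ℝ) :
    aeval (complexify x) h = (eval x h : ℂ) := by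
  have := MvPolynomial.comp_aeval_apply x Complex.ofRealAm h
  rw [← MvPolynomial.coe_aeval_eq_eval]
  exact this.symm

theorem aeval_complexify_ne_zero (hx : eval x h ≠ 0) : aeval (complexify x) h ≠ 0 := by
  rw [aeval_complexify]
  exact_mod_cast hx

theorem complexify_add_smul (x y : Fin n → ℝ) (t : ℝ) :
    complexify x + (t : ℂ) • complexify y = complexify (x + t • y) := by
  funext i
  simp [complexify]

theorem aeval_complexify_conj {z : ℂ} (hz : aeval (complexify x + z • complexify v) h = 0) :
    aeval (complexify x + (starRingEnd ℂ z) • complexify v) h = 0 := by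
  have := MvPolynomial.comp_aeval_apply (complexify x + z • complexify v)
    (Complex.conjAe : ℂ →ₐ[ℝ] ℂ) h
  rw [hz, map_zero] at this
  rw [this]
  congr 2
  funext i
  simp [complexify]

theorem eval_ne_zero_of_mem_hypCone (hv : v ∈ hypCone h e) {t : ℝ} (ht : 0 ≤ t) :
    eval (v + t • e) h ≠ 0 := by
  intro h0
  obtain ⟨r, hr, hr0⟩ := hv (t : ℂ) (by
    change aeval (complexify v + (t : ℂ) • complexify e) h = 0
    rw [complexify_add_smul, aeval_complexify, h0, Complex.ofReal_zero])
  exact absurd (Complex.ofReal_injective hr ▸ ht) (not_le.2 hr0)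

theorem self_mem_hypCone (hh : h.IsHomogeneous d) (he : eval e h ≠ 0) : e ∈ hypCone h e := by
  intro z hz
  change aeval (complexify e + z • complexify e) h = 0 at hz
  have : complexify e + z • complexify e = (1 + z) • complexify e := by
    rw [add_smul, one_smul]
  rw [this, aeval_smul_of_isHomogeneous hh, mul_eq_zero] at hz
  have h1 := eq_zero_of_pow_eq_zero (hz.resolve_right (aeval_complexify_ne_zero he))
  exact ⟨-1, by push_cast; linear_combination h1, by norm_num⟩

theorem eval_segment_ne_zero (hh : h.IsHomogeneous d) (he : eval e h ≠ 0)
    (hv : v ∈ hypCone h e) {s : ℝ} (hs : s ∈ Set.Icc (0 : ℝ) 1) :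
    eval ((1 - s) • v + s • e) h ≠ 0 := by
  rcases hs.2.eq_or_lt with rfl | hs1
  · simpa using he
  · have hs0 : 0 < 1 - s := sub_pos.2 hs1
    have : (1 - s) • v + s • e = (1 - s) • (v + (s / (1 - s)) • e) := by
      rw [smul_add, smul_smul, mul_div_cancel₀ _ hs0.ne']
    rw [this, ← MvPolynomial.coe_aeval_eq_eval]
    change aeval ((1 - s) • (v + (s / (1 - s)) • e)) h ≠ 0
    rw [aeval_smul_of_isHomogeneous hh]
    exact mul_ne_zero (pow_ne_zero _ hs0.ne')
      (eval_ne_zero_of_mem_hypCone hv (div_nonneg hs.1 hs0.le))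

theorem eval_pos_of_mem_hypCone (hh : h.IsHomogeneous d) (he : 0 < eval e h)
    (hv : v ∈ hypCone h e) : 0 < eval v h := by
  by_contra hneg
  have hc : Continuous fun s : ℝ => eval ((1 - s) • v + s • e) h :=
    (MvPolynomial.continuous_eval h).comp (by fun_prop)
  obtain ⟨s, hs, hs0⟩ := intermediate_value_Icc (zero_le_one (α := ℝ)) hc.continuousOn
    (show (0 : ℝ) ∈ _ from ⟨by simpa using hneg, by simpa using he.le⟩)
  exact eval_segment_ne_zero hh he.ne' hv hs hs0

theorem im_neg_of_mem_hypCone (hh : h.IsHomogeneous d) (hyp : IsHyperbolicWrt h e)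
    (hv : v ∈ hypCone h e) (x : Fin n → ℝ) {δ : ℝ} (hδ : 0 < δ) {z : ℂ}
    (hz : aeval (complexify x + (Complex.I * δ) • complexify e + z • complexify v) h = 0) :
    z.im < 0 := by
  have hv0 : eval v h ≠ 0 := by simpa using eval_ne_zero_of_mem_hypCone hv le_rfl
  refine roots_mem_of_homotopy hh (aeval_complexify_ne_zero hv0)
    (a := fun s => (s : ℂ) • complexify x + (Complex.I * δ) • complexify e)
    (by fun_prop) (A := {z | z.im < 0}) (B := {z | 0 < z.im})
    (isOpen_lt Complex.continuous_im continuous_const)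
    (isOpen_lt continuous_const Complex.continuous_im)
    (Set.disjoint_left.2 fun w (h1 : w.im < 0) (h2 : 0 < w.im) => lt_asymm h1 h2) ?_ ?_
    (by simpa using hz)
  · intro s _ w hw
    refine lt_or_gt_of_ne (a := w.im) (b := 0) fun him => ?_
    have hwre : w = (w.re : ℂ) := Complex.ext rfl (by simpa using him)
    have := hyp.2 (s • x + w.re • v) (Complex.I * δ) (by
      change aeval (complexify (s • x + w.re • v) + (Complex.I * δ) • complexify e) h = 0
      rw [← complexify_add_smul, ← hwre]
      convert hw using 2
      have : complexify (s • x) = (s : ℂ) • complexify x := by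
        funext i
        simp [complexify]
      rw [this, add_right_comm])
    simp at this
    exact hδ.ne' this
  · intro w hw
    simp only [Complex.ofReal_zero, zero_smul, zero_add] at hw
    have hw0 : w ≠ 0 := by
      rintro rfl
      rw [zero_smul, add_zero, aeval_smul_of_isHomogeneous hh, mul_eq_zero] at hw
      refine pow_ne_zero _ ?_ (hw.resolve_right (aeval_complexify_ne_zero hyp.1))
      exact mul_ne_zero Complex.I_ne_zero (by exact_mod_cast hδ.ne')
    have hsplit : (Complex.I * δ) • complexify e + w • complexify v =
        w • (complexify v + (Complex.I * δ / w) • complexify e) := by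
      rw [smul_add, smul_smul, mul_div_cancel₀ _ hw0, add_comm]
    rw [hsplit, aeval_smul_of_isHomogeneous hh, mul_eq_zero] at hw
    obtain ⟨r, hr, hr0⟩ := hv _ (hw.resolve_left (pow_ne_zero _ hw0))
    rw [div_eq_iff hw0] at hr
    have him := congrArg Complex.im hr
    simp at him
    change w.im < 0
    nlinarith

/-- Hyperbolicity with respect to one direction gives hyperbolicity with respect to every
direction of its cone. -/
theorem IsHyperbolicWrt.of_mem_hypCone (hh : h.IsHomogeneous d) (hyp : IsHyperbolicWrt h e)
    (hv : v ∈ hypCone h e) : IsHyperbolicWrt h v := by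
  have hv0 : eval v h ≠ 0 := by simpa using eval_ne_zero_of_mem_hypCone hv le_rfl
  have im_le : ∀ (x : Fin n → ℝ) (z : ℂ),
      aeval (complexify x + z • complexify v) h = 0 → z.im ≤ 0 := by
    intro x z hz
    by_contra! hpos
    have hopen := isOpen_setOf_exists_root hh (aeval_complexify_ne_zero hv0)
      (a := fun s => complexify x + (Complex.I * s) • complexify e) (by fun_prop)
      (isOpen_lt continuous_const Complex.continuous_im : IsOpen {z : ℂ | 0 < z.im})
    obtain ⟨ε, hε, hball⟩ := Metric.isOpen_iff.1 hopen 0 ⟨z, hpos, by simpa using hz⟩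
    obtain ⟨w, hw, hw0⟩ := hball (show ε / 2 ∈ _ by
      rw [Metric.mem_ball, dist_zero_right, Real.norm_of_nonneg (by positivity)]
      linarith)
    exact lt_asymm hw (im_neg_of_mem_hypCone hh hyp hv x (half_pos hε) hw0)
  refine ⟨hv0, fun x z hz => le_antisymm (im_le x z hz) ?_⟩
  have := im_le x _ (aeval_complexify_conj hz)
  simpa using this

theorem mem_hypCone_of_segment (hh : h.IsHomogeneous d) (hyp : IsHyperbolicWrt h v)
    (hx : x ∈ hypCone h v)
    (hseg : ∀ s ∈ Set.Icc (0 : ℝ) 1, eval ((1 - s) • x + s • y) h ≠ 0) : y ∈ hypCone h v := by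
  intro z hz
  change aeval (complexify y + z • complexify v) h = 0 at hz
  have hre : ∀ w : ℂ, w.im = 0 → w = (w.re : ℂ) := fun w hw => Complex.ext rfl (by simpa using hw)
  refine ⟨z.re, hre z (hyp.2 y z hz), ?_⟩
  refine roots_mem_of_homotopy hh (aeval_complexify_ne_zero hyp.1)
    (a := fun s => complexify ((1 - s) • x + s • y))
    (continuous_complexify.comp (by fun_prop)) (A := {z | z.re < 0}) (B := {z | 0 < z.re})
    (isOpen_lt Complex.continuous_re continuous_const)
    (isOpen_lt continuous_const Complex.continuous_re)
    (Set.disjoint_left.2 fun w (h1 : w.re < 0) (h2 : 0 < w.re) => lt_asymm h1 h2) ?_ ?_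
    (by simpa using hz)
  · intro s hs w hw
    refine lt_or_gt_of_ne (a := w.re) (b := 0) fun h0 => hseg s hs ?_
    have hw0 : w = 0 := Complex.ext h0 (hyp.2 _ w hw)
    rw [hw0, zero_smul, add_zero, aeval_complexify] at hw
    exact_mod_cast hw
  · intro w hw
    obtain ⟨r, rfl, hr⟩ := hx w (by
      change aeval (complexify x + w • complexify v) h = 0
      simpa using hw)
    exact hr

theorem mem_hypCone_of_mem_hypCone (hh : h.IsHomogeneous d) (hyp : IsHyperbolicWrt h e)
    (hv : v ∈ hypCone h e) (hu : u ∈ hypCone h e) : u ∈ hypCone h v := by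
  have hypv := hyp.of_mem_hypCone hh hv
  have he : e ∈ hypCone h v := mem_hypCone_of_segment hh hypv (self_mem_hypCone hh hypv.1)
    fun s hs => eval_segment_ne_zero hh hyp.1 hv hs
  refine mem_hypCone_of_segment hh hypv he fun s hs => ?_
  have := eval_segment_ne_zero hh hyp.1 hu (s := 1 - s) ⟨by linarith [hs.2], by linarith [hs.1]⟩
  rwa [sub_sub_cancel, add_comm] at this

/-- Gauss–Lucas for the directional derivative. -/
theorem mem_of_aeval_dirDeriv_eq_zero (hh : h.IsHomogeneous d) (hd : 0 < d)
    (hv : eval v h ≠ 0) {a : Fin n → ℂ} {S : Set ℂ} (hS : Convex ℝ S)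
    (hroots : ∀ w : ℂ, aeval (a + w • complexify v) h = 0 → w ∈ S)
    {z : ℂ} (hz : aeval (a + z • complexify v) (dirDeriv v h) = 0) : z ∈ S := by
  have hv' := aeval_complexify_ne_zero hv
  have hDv : eval v (dirDeriv v h) ≠ 0 := by
    rw [eval_dirDeriv_self hh]
    exact mul_ne_zero (by exact_mod_cast hd.ne') hv
  have hdeg : 0 < (linePoly h a (complexify v)).degree := by
    rw [← Polynomial.natDegree_pos_iff_degree_pos, linePoly_natDegree hh a hv']
    exact hd
  refine convexHull_min ?_ hS
    (Polynomial.rootSet_derivative_subset_convexHull_rootSet hdeg ?_)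
  · intro w hw
    have := (Polynomial.mem_rootSet.1 hw).2
    rw [Polynomial.coe_aeval_eq_eval, eval_linePoly] at this
    exact hroots w this
  · have hder : (linePoly h a (complexify v)).derivative =
        linePoly (dirDeriv v h) a (complexify v) := derivative_linePoly h a v
    rw [Polynomial.mem_rootSet, hder, Polynomial.coe_aeval_eq_eval, eval_linePoly]
    exact ⟨linePoly_ne_zero (hh.dirDeriv v) a (aeval_complexify_ne_zero hDv), hz⟩

theorem IsHyperbolicWrt.dirDeriv (hh : h.IsHomogeneous d) (hd : 0 < d)
    (hyp : IsHyperbolicWrt h v) : IsHyperbolicWrt (dirDeriv v h) v := by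
  refine ⟨?_, fun x z hz => ?_⟩
  · rw [eval_dirDeriv_self hh]
    exact mul_ne_zero (by exact_mod_cast hd.ne') hyp.1
  · exact mem_of_aeval_dirDeriv_eq_zero hh hd hyp.1 (a := complexify x) (S := {z | z.im = 0})
      (convex_hyperplane Complex.imLm.isLinear 0) (fun w hw => hyp.2 x w hw) hz

theorem hypCone_subset_hypCone_dirDeriv (hh : h.IsHomogeneous d) (hd : 0 < d)
    (hyp : IsHyperbolicWrt h v) : hypCone h v ⊆ hypCone (dirDeriv v h) v := by
  intro x hx z hz
  have him : z.im = 0 := (hyp.dirDeriv hh hd).2 x z hz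
  refine ⟨z.re, Complex.ext rfl (by simpa using him), ?_⟩
  refine mem_of_aeval_dirDeriv_eq_zero hh hd hyp.1 (a := complexify x) (S := {z | z.re < 0})
    (convex_halfSpace_lt Complex.reLm.isLinear 0) (fun w hw => ?_) hz
  obtain ⟨r, rfl, hr⟩ := hx w hw
  exact hr

end Garding

section Coefficients

open MvPolynomial

variable {n m d : ℕ}

/-- The polynomial `h(e₀ + x₁ E₁ + ⋯ + xₘ Eₘ)`. -/
noncomputable def affineSubst (h : MvPolynomial (Fin n) ℝ) (e₀ : Fin n → ℝ)
    (E : Fin m → Fin n → ℝ) : MvPolynomial (Fin m) ℝ :=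
  aeval (fun j => C (e₀ j) + ∑ i, C (E i j) * X i) h

theorem pderiv_affineSubst (h : MvPolynomial (Fin n) ℝ) (e₀ : Fin n → ℝ)
    (E : Fin m → Fin n → ℝ) (i : Fin m) :
    pderiv i (affineSubst h e₀ E) = affineSubst (dirDeriv (E i) h) e₀ E := by
  classical
  rw [affineSubst, affineSubst, derivation_aeval, aeval_dirDeriv]
  refine Finset.sum_congr rfl fun j _ => ?_
  congr 1
  simp [pderiv_X, Pi.single_apply, MvPolynomial.algebraMap_eq]

theorem coeff_zero_affineSubst (h : MvPolynomial (Fin n) ℝ) (e₀ : Fin n → ℝ)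
    (E : Fin m → Fin n → ℝ) : coeff 0 (affineSubst h e₀ E) = eval e₀ h := by
  rw [← constantCoeff_eq, affineSubst]
  have := MvPolynomial.map_aeval (fun j => C (e₀ j) + ∑ i, C (E i j) * X i)
    (constantCoeff (R := ℝ) (σ := Fin m)) h
  rw [this]
  have hid : (constantCoeff (R := ℝ) (σ := Fin m)).comp (algebraMap ℝ _) = RingHom.id ℝ := by
    ext r
    simp
  rw [hid]
  change eval _ h = eval e₀ h
  congr 2
  funext j
  simp

theorem coeff_affineSubst_nonneg (α : Fin m →₀ ℕ) (h : MvPolynomial (Fin n) ℝ) (d : ℕ)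
    (e : Fin n → ℝ) (hh : h.IsHomogeneous d) (hyp : IsHyperbolicWrt h e) (hpos : 0 < eval e h)
    {e₀ : Fin n → ℝ} (he₀ : e₀ ∈ hypCone h e) {E : Fin m → Fin n → ℝ}
    (hE : ∀ i, E i ∈ hypCone h e) : 0 ≤ coeff α (affineSubst h e₀ E) := by
  classical
  induction hk : α.degree generalizing α h d e with
  | zero =>
    rw [Finsupp.degree_eq_zero_iff] at hk
    rw [hk, coeff_zero_affineSubst]
    exact (eval_pos_of_mem_hypCone hh hpos he₀).le
  | succ k ih =>
    obtain ⟨i, hi⟩ : ∃ i, α i ≠ 0 := by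
      by_contra! hc
      have : α = 0 := Finsupp.ext hc
      simp [this] at hk
    obtain ⟨β, rfl⟩ : ∃ β, α = β + Finsupp.single i 1 :=
      ⟨α - Finsupp.single i 1,
        (tsub_add_cancel_of_le (by simpa using Nat.one_le_iff_ne_zero.2 hi)).symm⟩
    have hβ : β.degree = k := by simpa using hk
    have hcoef : coeff β (affineSubst (dirDeriv (E i) h) e₀ E) =
        coeff (β + Finsupp.single i 1) (affineSubst h e₀ E) * (β i + 1) := by
      rw [← pderiv_affineSubst, coeff_pderiv]
    suffices 0 ≤ coeff β (affineSubst (dirDeriv (E i) h) e₀ E) by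
      rw [hcoef] at this
      exact nonneg_of_mul_nonneg_left this (by positivity)
    rcases Nat.eq_zero_or_pos d with rfl | hd
    · have : dirDeriv (E i) h = 0 := by
        rw [← totalDegree_zero_iff_isHomogeneous, totalDegree_eq_zero_iff_eq_C] at hh
        rw [dirDeriv, hh]
        simp
      simp [this, affineSubst]
    · have hypE := hyp.of_mem_hypCone hh (hE i)
      have hsub := hypCone_subset_hypCone_dirDeriv hh hd hypE
      refine ih β _ (d - 1) (E i) (hh.dirDeriv _) (hypE.dirDeriv hh hd) ?_
        (hsub (mem_hypCone_of_mem_hypCone hh hyp (hE i) he₀))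
        (fun j => hsub (mem_hypCone_of_mem_hypCone hh hyp (hE i) (hE j))) hβ
      rw [eval_dirDeriv_self hh]
      exact mul_pos (by exact_mod_cast hd) (eval_pos_of_mem_hypCone hh hpos (hE i))

theorem continuous_coeff_affineSubst (h : MvPolynomial (Fin n) ℝ) (α : Fin m →₀ ℕ) :
    Continuous fun q : (Fin n → ℝ) × (Fin m → Fin n → ℝ) => coeff α (affineSubst h q.1 q.2) := by
  classical
  unfold affineSubst
  induction h using MvPolynomial.induction_on generalizing α with
  | C r => simpa using continuous_const
  | add p q hp hq =>
    simp only [map_add, coeff_add]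
    exact (hp α).add (hq α)
  | mul_X p j hp =>
    simp only [map_mul, aeval_X, coeff_mul]
    refine continuous_finsetSum _ fun β _ => (hp _).mul ?_
    simp only [coeff_add, coeff_C, coeff_sum, coeff_C_mul]
    split_ifs <;> fun_prop

theorem coeff_affineSubst_nonneg_of_mem_closure (α : Fin m →₀ ℕ) {h : MvPolynomial (Fin n) ℝ}
    {e : Fin n → ℝ} (hh : h.IsHomogeneous d) (hyp : IsHyperbolicWrt h e) (hpos : 0 < eval e h)
    {e₀ : Fin n → ℝ} (he₀ : e₀ ∈ closure (hypCone h e)) {E : Fin m → Fin n → ℝ}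
    (hE : ∀ i, E i ∈ closure (hypCone h e)) : 0 ≤ coeff α (affineSubst h e₀ E) := by
  have hmem : (e₀, E) ∈ closure (hypCone h e ×ˢ Set.pi Set.univ fun _ : Fin m => hypCone h e) := by
    rw [closure_prod_eq, closure_pi_set]
    exact ⟨he₀, fun i _ => hE i⟩
  have himg := map_mem_closure (t := Set.Ici (0 : ℝ)) (continuous_coeff_affineSubst h α) hmem
    fun q hq => coeff_affineSubst_nonneg α h d e hh hyp hpos hq.1
      fun i => hq.2 i (Set.mem_univ i)
  rw [isClosed_Ici.closure_eq] at himg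
  exact Set.mem_Ici.1 himg

end Coefficients

theorem stmt16 (n m d : ℕ) (h : MvPolynomial (Fin n) ℝ) (e : Fin n → ℝ)
    (hhom : h.IsHomogeneous d) (hhyp : IsHyperbolicWrt h e)
    (hpos : 0 < MvPolynomial.eval e h)
    (e₀ : Fin n → ℝ) (he₀ : e₀ ∈ closure (hypCone h e))
    (E : Fin m → (Fin n → ℝ)) (hE : ∀ i, E i ∈ closure (hypCone h e)) :
    ∀ α : Fin m →₀ ℕ,
      0 ≤ MvPolynomial.coeff α (MvPolynomial.aeval
        (fun j => MvPolynomial.C (e₀ j) + ∑ i, MvPolynomial.C (E i j) * MvPolynomial.X i) h) := by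
  intro α
  exact coeff_affineSubst_nonneg_of_mem_closure α hhom hhyp hpos he₀ hE
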